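/- arXiv:1708.09708 — 9 statements merged into one kernel-verified Lean document; each statement's English description precedes it below -/
import Mathlib

section
/- For every function h : A → B between finite alphabets, every stream σ over A, and every word w over A, the pulled-back feature overestimates the original feature: Φ_w(σ) ≤ Φ_{h,w}(σ), where the features are taken with respect to the event map p(λ,a) = exp(λa). -/
open scoped BigOperators Classical

/-- Feature coordinates of a stream `σ` at a word `w` for the event map `p(λ,a) = 1 + λ a`:
the sum over all strictly increasing index tuples whose letters spell `w` of the product of
the counter increases. -/
noncomputable def Phi {A : Type*} (σ : List (ℝ × A)) (w : List A) : ℝ :=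
  ∑ i : Fin w.length → Fin σ.length,
    if (∀ j k : Fin w.length, j < k → i j < i k) ∧
        (∀ j : Fin w.length, (σ.get (i j)).2 = w.get j) then
      ∏ j : Fin w.length, (σ.get (i j)).1
    else 0

/-- The block factorial `𝐢!` of a (nondecreasing) index tuple: the product over values of the
factorial of the number of occurrences. -/
def iFact {M L : ℕ} (i : Fin M → Fin L) : ℕ :=
  ∏ v : Fin L, Nat.factorial ((List.ofFn i).count v)

/-- Feature coordinates of a stream `σ` at a word `w` for the event map `p(λ,a) = exp(λ a)`:
the sum over all nondecreasing index tuples whose letters spell `w` of the product of the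
counter increases divided by the block factorial `𝐢!`. -/
noncomputable def PhiExp {A : Type*} (σ : List (ℝ × A)) (w : List A) : ℝ :=
  ∑ i : Fin w.length → Fin σ.length,
    if (∀ j k : Fin w.length, j ≤ k → i j ≤ i k) ∧
        (∀ j : Fin w.length, (σ.get (i j)).2 = w.get j) then
      (∏ j : Fin w.length, (σ.get (i j)).1) / (iFact i : ℝ)
    else 0

/-- The hashed stream `σ^h`. -/
def hashStream {A B : Type*} (h : A → B) (σ : List (ℝ × A)) : List (ℝ × B) :=
  σ.map (fun e => (e.1, h e.2))

/-- Pulled-back features `Φ_{h,w}(σ) := Φ_{h(w)}(σ^h)` for the event map `p(λ,a) = 1 + λ a`. -/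
noncomputable def PhiH {A B : Type*} (h : A → B) (σ : List (ℝ × A)) (w : List A) : ℝ :=
  Phi (hashStream h σ) (w.map h)

/-- Pulled-back features `Φ_{h,w}(σ) := Φ_{h(w)}(σ^h)` for the event map `p(λ,a) = exp(λ a)`. -/
noncomputable def PhiExpH {A B : Type*} (h : A → B) (σ : List (ℝ × A)) (w : List A) : ℝ :=
  PhiExp (hashStream h σ) (w.map h)

/-- `‖Φ(σ)‖_{1,(M)}`: the sum of the features over all words of length `M`. -/
noncomputable def phiNorm {A : Type*} [Fintype A] (σ : List (ℝ × A)) (M : ℕ) : ℝ :=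
  ∑ f : Fin M → A, Phi σ (List.ofFn f)

/-- Probability of an event `S` under a finitely supported weight `p`. -/
noncomputable def pr {Ω : Type*} [Fintype Ω] (p : Ω → ℝ) (S : Ω → Prop) : ℝ :=
  ∑ ω : Ω, if S ω then p ω else 0

/-- Expectation of `f` under a finitely supported weight `p`. -/
noncomputable def expec {Ω : Type*} [Fintype Ω] (p : Ω → ℝ) (f : Ω → ℝ) : ℝ :=
  ∑ ω : Ω, p ω * f ω

/-- `PhiExp` with the lengths of the word and of the stream replaced by equal numbers. -/
theorem PhiExp_eq_sum_cast {A : Type*} (σ : List (ℝ × A)) (w : List A) {M L : ℕ}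
    (hM : M = w.length) (hL : L = σ.length) :
    PhiExp σ w = ∑ i : Fin M → Fin L,
      if (∀ j k : Fin M, j ≤ k → i j ≤ i k) ∧
          (∀ j : Fin M, (σ.get ((i j).cast hL)).2 = w.get (j.cast hM)) then
        (∏ j : Fin M, (σ.get ((i j).cast hL)).1) / (iFact i : ℝ)
      else 0 := by
  subst hM hL
  rfl

/-- The entries of the hashed stream. -/
theorem hashStream_get_cast {A B : Type*} (h : A → B) (σ : List (ℝ × A))
    (hL : σ.length = (hashStream h σ).length) (x : Fin σ.length) :
    (hashStream h σ).get (x.cast hL) = ((σ.get x).1, h (σ.get x).2) :=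
  List.getElem_map _

/-- For every function `h : A → B` between finite alphabets, every stream `σ` over `A` and
every word `w`, the pulled-back feature overestimates the original feature, for the event map
`p(λ,a) = exp(λ a)`. -/
theorem pullback_overestimates_exp {A B : Type*} [Fintype A] [Fintype B]
    (h : A → B) (σ : List (ℝ × A)) (hσ : ∀ e ∈ σ, 0 < e.1) (w : List A) :
    PhiExp σ w ≤ PhiExpH h σ w := by
  rw [PhiExpH, PhiExp_eq_sum_cast (hashStream h σ) (w.map h) (M := w.length) (L := σ.length)
    (by simp) (by simp [hashStream]), PhiExp]
  simp only [hashStream_get_cast]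
  refine Finset.sum_le_sum fun i _ => ?_
  by_cases hi : (∀ j k : Fin w.length, j ≤ k → i j ≤ i k) ∧
      (∀ j : Fin w.length, (σ.get (i j)).2 = w.get j)
  · rw [if_pos hi, if_pos]
    refine ⟨hi.1, fun j => ?_⟩
    simpa using congrArg h (hi.2 j)
  · rw [if_neg hi]
    split_ifs
    · exact div_nonneg (Finset.prod_nonneg fun j _ => (hσ _ (List.get_mem σ (i j))).le)
        (Nat.cast_nonneg _)
    · exact le_rfl
end

section
/- Let h : A → B be a function between finite alphabets and σ = ((λ_i,a_i))_{i=1}^L a stream over A. For the event map p(λ,a) = 1+λa, the bias of the pulled-back feature at a word w of length M is exactly Φ_{h,w}(σ) − Φ_w(σ) = Σ λ_{i_1}⋯λ_{i_M}, the sum over all strictly increasing index tuples 1 ≤ i_1 < ⋯ < i_M ≤ L such that the letter word a_{i_1}⋯a_{i_M} is different from w but h(a_{i_1})⋯h(a_{i_M}) = h(w). -/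
open scoped BigOperators Classical

/-- Pulled-back features as a sum over index tuples of the original stream. -/
theorem PhiH_eq_sum {A B : Type*} (h : A → B) (σ : List (ℝ × A)) (w : List A) :
    PhiH h σ w =
      ∑ i : Fin w.length → Fin σ.length,
        if (∀ j k : Fin w.length, j < k → i j < i k) ∧
            (∀ j : Fin w.length, h (σ.get (i j)).2 = h (w.get j)) then
          ∏ j : Fin w.length, (σ.get (i j)).1
        else 0 := by
  have hw : w.length = (w.map h).length := by simp
  have hs : σ.length = (hashStream h σ).length := by simp [hashStream]
  unfold PhiH Phi
  symm
  refine Fintype.sum_equiv ((finCongr hw).arrowCongr (finCongr hs)) _ _ fun i => ?_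
  have hprod : ∏ j, ((hashStream h σ).get (((finCongr hw).arrowCongr (finCongr hs)) i j)).1 =
      ∏ j, (σ.get (i j)).1 := by
    symm
    refine Fintype.prod_equiv (finCongr hw) _ _ fun j => ?_
    simp [hashStream]
    rfl
  rw [hprod]
  congr 1
  refine propext (and_congr ?_ ?_)
  · rw [(finCongr hw).forall_congr_left]
    refine forall_congr' fun j => ?_
    rw [(finCongr hw).forall_congr_left]
    exact Iff.rfl
  · rw [(finCongr hw).forall_congr_left]
    refine forall_congr' fun j => ?_
    simp [hashStream]
    rfl

/-- A tuple spells a word exactly when all its letters agree with those of the word. -/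
theorem ofFn_eq_iff_forall_get {A : Type*} (w : List A) (f : Fin w.length → A) :
    List.ofFn f = w ↔ ∀ j, f j = w.get j := by
  conv_lhs => rhs; rw [← List.ofFn_get w]
  rw [List.ofFn_inj, funext_iff]

/-- A tuple spells a word up to `h` exactly when all its letters agree with those of the word
up to `h`. -/
theorem map_ofFn_eq_map_iff {A B : Type*} (h : A → B) (w : List A) (f : Fin w.length → A) :
    (List.ofFn f).map h = w.map h ↔ ∀ j, h (f j) = h (w.get j) := by
  conv_lhs => rhs; rw [← List.ofFn_get w]
  rw [List.map_ofFn, List.map_ofFn, List.ofFn_inj, funext_iff]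
  rfl

/-- Exact bias formula for the event map `p(λ,a) = 1 + λ a`: the bias at the word `w` is the
sum over strictly increasing index tuples whose letter word differs from `w` but hashes to the
hash of `w`. -/
theorem bias_formula {A B : Type*} [Fintype A] [Fintype B]
    (h : A → B) (σ : List (ℝ × A)) (hσ : ∀ e ∈ σ, 0 < e.1) (w : List A) :
    PhiH h σ w - Phi σ w =
      ∑ i : Fin w.length → Fin σ.length,
        if (∀ j k : Fin w.length, j < k → i j < i k) ∧
            List.ofFn (fun j => (σ.get (i j)).2) ≠ w ∧
            (List.ofFn (fun j => (σ.get (i j)).2)).map h = w.map h then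
          ∏ j : Fin w.length, (σ.get (i j)).1
        else 0 := by
  rw [PhiH_eq_sum, Phi, ← Finset.sum_sub_distrib]
  refine Finset.sum_congr rfl fun i _ => ?_
  simp only [map_ofFn_eq_map_iff, ne_eq, ofFn_eq_iff_forall_get]
  have hash_of_eq : (∀ j, (σ.get (i j)).2 = w.get j) →
      ∀ j, h (σ.get (i j)).2 = h (w.get j) := fun H j => congrArg h (H j)
  by_cases h1 : ∀ j k : Fin w.length, j < k → i j < i k <;>
    by_cases h2 : ∀ j, (σ.get (i j)).2 = w.get j <;>
    by_cases h3 : ∀ j, h (σ.get (i j)).2 = h (w.get j)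
  all_goals first
    | exact absurd (hash_of_eq h2) h3
    | simp only [h1, h2, h3, implies_true, and_true, and_false, not_true,
        not_false_iff, if_false, sub_self, sub_zero]
end

section
/- Let H be a random function A → B drawn from a finite probability space such that for all distinct words v, w over A of the same length M one has ℙ(H(v) = H(w)) ≤ q, where H acts on words letterwise and q > 0. Then for every stream σ over A and every word w of length M, ℙ( Φ_w(σ) ∈ [Φ_{H,w}(σ) − 2q‖Φ(σ)‖_{1,(M)}, Φ_{H,w}(σ)] ) ≥ 1/2, where the features are taken with respect to the event map p(λ,a) = 1+λa. -/
open scoped BigOperators Classical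

theorem Phi_ofFn {A : Type*} {n M : ℕ} (x : Fin n → ℝ × A) (f : Fin M → A) :
    Phi (List.ofFn x) (List.ofFn f) =
      ∑ i : Fin M → Fin n,
        if (∀ j k : Fin M, j < k → i j < i k) ∧ (∀ j : Fin M, (x (i j)).2 = f j) then
          ∏ j : Fin M, (x (i j)).1
        else 0 := by
  have key : ∀ (σ : List (ℝ × A)) (w : List A) (hn : σ.length = n) (hM : w.length = M),
      Phi σ w = ∑ i : Fin M → Fin n,
        if (∀ j k : Fin M, j < k → i j < i k) ∧
            (∀ j : Fin M, (σ.get ((i j).cast hn.symm)).2 = w.get (j.cast hM.symm)) then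
          ∏ j : Fin M, (σ.get ((i j).cast hn.symm)).1
        else 0 := by
    intro σ w hn hM
    subst hn hM
    rfl
  rw [key _ _ (List.length_ofFn) (List.length_ofFn)]
  simp

theorem Phi_nonneg {A : Type*} (σ : List (ℝ × A)) (hσ : ∀ e ∈ σ, 0 < e.1)
    (w : List A) : 0 ≤ Phi σ w := by
  unfold Phi
  refine Finset.sum_nonneg fun i _ => ?_
  split_ifs
  · exact Finset.prod_nonneg fun j _ => (hσ _ (List.get_mem _ _)).le
  · exact le_rfl

/-- A pulled-back feature is the sum of the features over all words colliding with the given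
one. -/
theorem PhiH_ofFn_eq_sum {A B : Type*} [Fintype A] {M : ℕ} (h : A → B) (σ : List (ℝ × A))
    (f : Fin M → A) :
    PhiH h σ (List.ofFn f) =
      ∑ g : Fin M → A,
        if (List.ofFn g).map h = (List.ofFn f).map h then Phi σ (List.ofFn g) else 0 := by
  obtain ⟨n, x, rfl⟩ : ∃ (n : ℕ) (x : Fin n → ℝ × A), σ = List.ofFn x :=
    ⟨_, σ.get, (List.ofFn_get σ).symm⟩
  simp only [PhiH, hashStream, List.map_ofFn, Phi_ofFn, Function.comp_apply,
    List.ofFn_inj]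
  have push : ∀ g : Fin M → A,
      (if h ∘ g = h ∘ f then
        ∑ i : Fin M → Fin n,
          if (∀ j k : Fin M, j < k → i j < i k) ∧ (∀ j : Fin M, (x (i j)).2 = g j) then
            ∏ j : Fin M, (x (i j)).1
          else 0
      else 0) =
        ∑ i : Fin M → Fin n,
          if g = fun j => (x (i j)).2 then
            if (∀ j k : Fin M, j < k → i j < i k) ∧ (∀ j : Fin M, h (x (i j)).2 = h (f j)) then
              ∏ j : Fin M, (x (i j)).1
            else 0
          else 0 := by
    intro g
    split_ifs with hg
    · refine Finset.sum_congr rfl fun i _ => ?_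
      by_cases hi : g = fun j => (x (i j)).2
      · subst hi
        have hg' := congrFun hg
        simp only [Function.comp_apply] at hg'
        simp [hg']
      · have hne : ¬ ∀ j, (x (i j)).2 = g j := fun H => hi (funext fun j => (H j).symm)
        simp [hi, hne]
    · refine (Finset.sum_eq_zero fun i _ => ?_).symm
      split_ifs with hi hc
      · exact absurd (funext fun j => by simpa [hi] using hc.2 j) hg
      · rfl
      · rfl
  simp only [push]
  rw [Finset.sum_comm]
  simp

/-- Markov's inequality at twice an upper bound of the mean. -/
theorem half_le_pr_of_expec_le {Ω : Type*} [Fintype Ω] (p : Ω → ℝ) (hp : ∀ ω, 0 ≤ p ω)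
    (hp1 : ∑ ω, p ω = 1) (X : Ω → ℝ) (hX : ∀ ω, 0 ≤ X ω) {c : ℝ} (hc : 0 < c)
    (hXc : expec p X ≤ c) : 1 / 2 ≤ pr p (fun ω => X ω ≤ 2 * c) := by
  have hpt : ∀ ω, p ω * (2 * c) ≤ (if X ω ≤ 2 * c then p ω else 0) * (2 * c) + p ω * X ω := by
    intro ω
    split_ifs with h
    · linarith [mul_nonneg (hp ω) (hX ω)]
    · linarith [mul_le_mul_of_nonneg_left (not_le.1 h).le (hp ω)]
  have hsum := Finset.sum_le_sum fun ω (_ : ω ∈ Finset.univ) => hpt ω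
  rw [Finset.sum_add_distrib, ← Finset.sum_mul, ← Finset.sum_mul, hp1] at hsum
  unfold expec at hXc
  unfold pr
  nlinarith

/-- If the random hash `H` has pairwise word-collision probability at most `q > 0` on words of
length `M`, then with probability at least `1/2` the true feature lies in
`[Φ_{H,w}(σ) - 2q‖Φ(σ)‖_{1,(M)}, Φ_{H,w}(σ)]`, for the event map `p(λ,a) = 1 + λ a`. -/
theorem single_hash_half_bound {A B Ω : Type*} [Fintype A] [Fintype B] [Fintype Ω]
    (p : Ω → ℝ) (hp : ∀ ω, 0 ≤ p ω) (hp1 : ∑ ω, p ω = 1)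
    (H : Ω → A → B) (M : ℕ) (q : ℝ) (hq : 0 < q)
    (hcoll : ∀ v w : List A, v.length = M → w.length = M → v ≠ w →
      pr p (fun ω => v.map (H ω) = w.map (H ω)) ≤ q)
    (σ : List (ℝ × A)) (hσ : ∀ e ∈ σ, 0 < e.1)
    (w : List A) (hw : w.length = M) :
    (1 : ℝ) / 2 ≤
      pr p (fun ω => PhiH (H ω) σ w - 2 * q * phiNorm σ M ≤ Phi σ w ∧
        Phi σ w ≤ PhiH (H ω) σ w) := by
  subst hw
  obtain ⟨M, f, rfl⟩ : ∃ (M : ℕ) (f : Fin M → A), w = List.ofFn f :=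
    ⟨_, w.get, (List.ofFn_get w).symm⟩
  rw [List.length_ofFn] at hcoll ⊢
  have hnn : ∀ g : Fin M → A, 0 ≤ Phi σ (List.ofFn g) := fun g => Phi_nonneg σ hσ _
  set X : Ω → ℝ := fun ω => ∑ g ∈ Finset.univ.erase f,
    if (List.ofFn g).map (H ω) = (List.ofFn f).map (H ω) then Phi σ (List.ofFn g) else 0
    with hXdef
  have hPhiH : ∀ ω, PhiH (H ω) σ (List.ofFn f) = Phi σ (List.ofFn f) + X ω := by
    intro ω
    rw [PhiH_ofFn_eq_sum, ← Finset.add_sum_erase _ _ (Finset.mem_univ f), if_pos rfl]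
  have hX : ∀ ω, 0 ≤ X ω := fun ω => Finset.sum_nonneg fun g _ => by
    split_ifs
    exacts [hnn g, le_rfl]
  have herase : ∑ g ∈ Finset.univ.erase f, Phi σ (List.ofFn g) ≤ phiNorm σ M :=
    Finset.sum_le_sum_of_subset_of_nonneg (Finset.erase_subset _ _) fun g _ _ => hnn g
  have hXN : ∀ ω, X ω ≤ phiNorm σ M := fun ω =>
    (Finset.sum_le_sum fun g _ => by
      split_ifs
      exacts [le_rfl, hnn g]).trans herase
  have hexp : expec p X ≤ q * phiNorm σ M := by
    calc expec p X
        = ∑ g ∈ Finset.univ.erase f,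
            pr p (fun ω => (List.ofFn g).map (H ω) = (List.ofFn f).map (H ω)) *
              Phi σ (List.ofFn g) := by
          simp only [expec, pr, hXdef, Finset.mul_sum, Finset.sum_mul]
          rw [Finset.sum_comm]
          simp only [mul_ite, ite_mul, mul_zero, zero_mul]
      _ ≤ ∑ g ∈ Finset.univ.erase f, q * Phi σ (List.ofFn g) := by
          refine Finset.sum_le_sum fun g hg => mul_le_mul_of_nonneg_right ?_ (hnn g)
          exact hcoll _ _ List.length_ofFn List.length_ofFn fun h =>
            Finset.ne_of_mem_erase hg (List.ofFn_injective h)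
      _ ≤ q * phiNorm σ M := by
          rw [← Finset.mul_sum]
          exact mul_le_mul_of_nonneg_left herase hq.le
  have hevent : (fun ω => PhiH (H ω) σ (List.ofFn f) - 2 * q * phiNorm σ M ≤ Phi σ (List.ofFn f) ∧
      Phi σ (List.ofFn f) ≤ PhiH (H ω) σ (List.ofFn f)) =
      fun ω => X ω ≤ 2 * (q * phiNorm σ M) := by
    funext ω
    rw [hPhiH]
    exact propext ⟨fun h => by linarith [h.1], fun h => ⟨by linarith, by linarith [hX ω]⟩⟩
  rw [hevent]
  have hN : 0 ≤ phiNorm σ M := Finset.sum_nonneg fun g _ => hnn g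
  rcases hN.eq_or_lt with hN0 | hNpos
  · have hall : ∀ ω, X ω ≤ 2 * (q * phiNorm σ M) := fun ω => by
      have := hXN ω
      rw [← hN0] at this ⊢
      simpa using this
    simp only [pr, hall, if_true, hp1]
    norm_num
  · exact half_le_pr_of_expec_le p hp hp1 X hX (mul_pos hq hNpos) hexp
end

section
/- Let H_1, …, H_r be independent, identically distributed random functions A → B (each drawn from the same finite probability space), such that for each j and all distinct words v, w over A of the same length M one has ℙ(H_j(v) = H_j(w)) ≤ q, where the H_j act on words letterwise and q > 0. Then for every stream σ over A and every word w of length M: (1) ℙ( min_{j=1,…,r} Φ_{H_j,w}(σ) − Φ_w(σ) > 2q‖Φ(σ)‖_{1,(M)} ) ≤ 2^{−r}; and (2) ℙ( Φ_w(σ) ∈ [min_j Φ_{H_j,w}(σ) − 2q‖Φ(σ)‖_{1,(M)}, min_j Φ_{H_j,w}(σ)] ) ≥ 1 − 2^{−r}. The features are taken with respect to the event map p(λ,a) = 1+λa. -/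
open scoped BigOperators Classical

theorem Phi_eq_sum {A : Type*} (σ : List (ℝ × A)) (w : List A) {M L : ℕ}
    (hw : w.length = M) (hL : σ.length = L) :
    Phi σ w = ∑ i : Fin M → Fin L,
      if (∀ j k : Fin M, j < k → i j < i k) ∧
          (∀ j : Fin M, (σ.get ((i j).cast hL.symm)).2 = w.get (j.cast hw.symm)) then
        ∏ j : Fin M, (σ.get ((i j).cast hL.symm)).1
      else 0 := by
  subst hw hL
  rfl

/-- A hashed feature is the sum of the features of all words colliding with the given one. -/
theorem PhiH_eq_sum_collisions {A B : Type*} [Fintype A] (h : A → B) (σ : List (ℝ × A))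
    {M : ℕ} (g : Fin M → A) :
    PhiH h σ (List.ofFn g) = ∑ f : Fin M → A,
      if (List.ofFn f).map h = (List.ofFn g).map h then Phi σ (List.ofFn f) else 0 := by
  have hmap : ∀ f : Fin M → A,
      (List.ofFn f).map h = (List.ofFn g).map h ↔ ∀ j, h (f j) = h (g j) := fun f => by
    rw [List.map_ofFn, List.map_ofFn, List.ofFn_injective.eq_iff, funext_iff]
    rfl
  have hlen : (hashStream h σ).length = σ.length := by simp [hashStream]
  have hget : ∀ i : Fin σ.length,
      (hashStream h σ).get (i.cast hlen.symm) = ((σ.get i).1, h (σ.get i).2) := fun i => by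
    simp only [hashStream, List.get_eq_getElem, List.getElem_map]
    rfl
  rw [PhiH, Phi_eq_sum (M := M) (hashStream h σ) _ (by simp) hlen]
  simp_rw [hmap, fun f : Fin M → A =>
    Phi_eq_sum (M := M) σ (List.ofFn f) (by simp) (rfl : σ.length = σ.length)]
  simp_rw [← Finset.sum_filter (fun f : Fin M → A => ∀ j, h (f j) = h (g j))]
  rw [Finset.sum_comm]
  refine Finset.sum_congr rfl fun i _ => ?_
  rw [Finset.sum_filter, Finset.sum_eq_single (fun j => (σ.get (i j)).2)]
  · simp_rw [hget]
    simp only [List.get_eq_getElem, List.getElem_map, List.getElem_ofFn, Fin.val_cast, Fin.eta,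
      Fin.cast_eq_self]
    split_ifs <;> simp_all
  · intro f _ hf
    have hne : ¬ ∀ j, (σ.get (i j)).2 = f j := fun hj => hf (funext hj).symm
    simp_all
  · simp

theorem pr_nonneg {Ω : Type*} [Fintype Ω] {p : Ω → ℝ} (hp : ∀ ω, 0 ≤ p ω) (S : Ω → Prop) :
    0 ≤ pr p S :=
  Finset.sum_nonneg fun ω _ => by split_ifs <;> simp [hp]

theorem pr_mono {Ω : Type*} [Fintype Ω] {p : Ω → ℝ} (hp : ∀ ω, 0 ≤ p ω) {S T : Ω → Prop}
    (hST : ∀ ω, S ω → T ω) : pr p S ≤ pr p T := by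
  refine Finset.sum_le_sum fun ω _ => ?_
  by_cases hS : S ω
  · simp [hS, hST ω hS]
  · rw [if_neg hS]
    split_ifs <;> simp [hp]

theorem pr_add_pr_not {Ω : Type*} [Fintype Ω] (p : Ω → ℝ) (S : Ω → Prop) :
    pr p S + pr p (fun ω => ¬ S ω) = ∑ ω, p ω := by
  rw [pr, pr, ← Finset.sum_add_distrib]
  refine Finset.sum_congr rfl fun ω _ => ?_
  by_cases hS : S ω <;> simp [hS]

/-- Independence: the probability that an event occurs in all `r` independent draws. -/
theorem pr_pi_forall {Ω : Type*} [Fintype Ω] (p : Ω → ℝ) (S : Ω → Prop) (r : ℕ) :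
    pr (fun ω : Fin r → Ω => ∏ j, p (ω j)) (fun ω => ∀ j, S (ω j)) = pr p S ^ r := by
  rw [pr, pr, Fintype.sum_pow]
  refine Finset.sum_congr rfl fun ω _ => ?_
  rw [Finset.prod_ite_zero]
  simp

/-- Markov's inequality. -/
theorem mul_pr_lt_le_expec {Ω : Type*} [Fintype Ω] {p : Ω → ℝ} (hp : ∀ ω, 0 ≤ p ω)
    {X : Ω → ℝ} (hX : ∀ ω, 0 ≤ X ω) (t : ℝ) :
    t * pr p (fun ω => t < X ω) ≤ expec p X := by
  rw [pr, expec, Finset.mul_sum]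
  refine Finset.sum_le_sum fun ω _ => ?_
  split_ifs with h
  · nlinarith [hp ω]
  · simpa using mul_nonneg (hp ω) (hX ω)

/-- The excess of a hashed feature is the sum over the other colliding words. -/
theorem PhiH_sub_Phi {A B : Type*} [Fintype A] (h : A → B) (σ : List (ℝ × A))
    {M : ℕ} (g : Fin M → A) :
    PhiH h σ (List.ofFn g) - Phi σ (List.ofFn g) = ∑ f ∈ Finset.univ.erase g,
      if (List.ofFn f).map h = (List.ofFn g).map h then Phi σ (List.ofFn f) else 0 := by
  rw [PhiH_eq_sum_collisions, ← Finset.add_sum_erase _ _ (Finset.mem_univ g), if_pos rfl,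
    add_sub_cancel_left]

theorem PhiH_sub_Phi_nonneg {A B : Type*} [Fintype A] (h : A → B) (σ : List (ℝ × A))
    (hσ : ∀ e ∈ σ, 0 < e.1) {M : ℕ} (g : Fin M → A) :
    0 ≤ PhiH h σ (List.ofFn g) - Phi σ (List.ofFn g) := by
  rw [PhiH_sub_Phi]
  refine Finset.sum_nonneg fun f _ => ?_
  split_ifs
  exacts [Phi_nonneg σ hσ _, le_rfl]

theorem PhiH_sub_Phi_le_phiNorm {A B : Type*} [Fintype A] (h : A → B) (σ : List (ℝ × A))
    (hσ : ∀ e ∈ σ, 0 < e.1) {M : ℕ} (g : Fin M → A) :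
    PhiH h σ (List.ofFn g) - Phi σ (List.ofFn g) ≤ phiNorm σ M := by
  refine (sub_le_self _ (Phi_nonneg σ hσ _)).trans ?_
  rw [PhiH_eq_sum_collisions, phiNorm]
  refine Finset.sum_le_sum fun f _ => ?_
  split_ifs
  exacts [le_rfl, Phi_nonneg σ hσ _]

theorem expec_PhiH_sub_Phi_le {A B Ω : Type*} [Fintype A] [Fintype Ω]
    (p : Ω → ℝ) (H : Ω → A → B) {M : ℕ} {q : ℝ} (hq : 0 ≤ q)
    (hcoll : ∀ v w : List A, v.length = M → w.length = M → v ≠ w →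
      pr p (fun ω => v.map (H ω) = w.map (H ω)) ≤ q)
    (σ : List (ℝ × A)) (hσ : ∀ e ∈ σ, 0 < e.1) (g : Fin M → A) :
    expec p (fun ω => PhiH (H ω) σ (List.ofFn g) - Phi σ (List.ofFn g)) ≤
      q * phiNorm σ M := by
  simp_rw [expec, PhiH_sub_Phi, Finset.mul_sum]
  rw [Finset.sum_comm, phiNorm, Finset.mul_sum]
  calc _ ≤ ∑ f ∈ Finset.univ.erase g, q * Phi σ (List.ofFn f) := by
        refine Finset.sum_le_sum fun f hf => ?_
        have hne : List.ofFn f ≠ List.ofFn g :=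
          List.ofFn_injective.ne (Finset.ne_of_mem_erase hf)
        refine le_trans (le_of_eq ?_) (mul_le_mul_of_nonneg_right
          (hcoll _ _ (by simp) (by simp) hne) (Phi_nonneg σ hσ (List.ofFn f)))
        rw [pr, Finset.sum_mul]
        refine Finset.sum_congr rfl fun ω _ => ?_
        split_ifs <;> simp
    _ ≤ _ := Finset.sum_le_sum_of_subset_of_nonneg (Finset.erase_subset _ _)
        fun f _ _ => mul_nonneg hq (Phi_nonneg σ hσ _)

theorem pr_PhiH_sub_Phi_gt_le_half {A B Ω : Type*} [Fintype A] [Fintype Ω]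
    (p : Ω → ℝ) (hp : ∀ ω, 0 ≤ p ω) (H : Ω → A → B) {M : ℕ} {q : ℝ} (hq : 0 < q)
    (hcoll : ∀ v w : List A, v.length = M → w.length = M → v ≠ w →
      pr p (fun ω => v.map (H ω) = w.map (H ω)) ≤ q)
    (σ : List (ℝ × A)) (hσ : ∀ e ∈ σ, 0 < e.1) (g : Fin M → A) :
    pr p (fun ω => 2 * q * phiNorm σ M <
      PhiH (H ω) σ (List.ofFn g) - Phi σ (List.ofFn g)) ≤ 2⁻¹ := by
  have hN : 0 ≤ phiNorm σ M := Finset.sum_nonneg fun f _ => Phi_nonneg σ hσ _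
  rcases hN.eq_or_lt with h0 | hpos
  · have hle := fun ω => PhiH_sub_Phi_le_phiNorm (H ω) σ hσ g
    simp_rw [← h0] at hle ⊢
    simp [pr, (hle _).not_gt]
  · have hmarkov := (mul_pr_lt_le_expec hp (fun ω => PhiH_sub_Phi_nonneg (H ω) σ hσ g)
      (2 * q * phiNorm σ M)).trans (expec_PhiH_sub_Phi_le p H hq.le hcoll σ hσ g)
    refine le_of_mul_le_mul_left (hmarkov.trans (le_of_eq ?_))
      (by positivity : 0 < 2 * q * phiNorm σ M)
    ring

/-- Combining `r` i.i.d. hashes by taking the minimum: the minimum overestimates `Φ_w(σ)` by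
more than `2q‖Φ(σ)‖_{1,(M)}` with probability at most `2^{-r}`, and with probability at least
`1 - 2^{-r}` the true feature lies in the corresponding interval.  Independence is modeled by
the `r`-fold product probability space; features use the event map `p(λ,a) = 1 + λ a`. -/
theorem min_of_independent_hashes {A B Ω : Type*} [Fintype A] [Fintype B] [Fintype Ω]
    (p : Ω → ℝ) (hp : ∀ ω, 0 ≤ p ω) (hp1 : ∑ ω, p ω = 1)
    (H : Ω → A → B) (M : ℕ) (q : ℝ) (hq : 0 < q)
    (hcoll : ∀ v w : List A, v.length = M → w.length = M → v ≠ w →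
      pr p (fun ω => v.map (H ω) = w.map (H ω)) ≤ q)
    (r : ℕ) (σ : List (ℝ × A)) (hσ : ∀ e ∈ σ, 0 < e.1)
    (w : List A) (hw : w.length = M) :
    pr (fun ω : Fin r → Ω => ∏ j, p (ω j))
        (fun ω => 2 * q * phiNorm σ M <
          (⨅ j : Fin r, PhiH (H (ω j)) σ w) - Phi σ w) ≤ (2 : ℝ)⁻¹ ^ r ∧
      1 - (2 : ℝ)⁻¹ ^ r ≤
        pr (fun ω : Fin r → Ω => ∏ j, p (ω j))
          (fun ω => (⨅ j : Fin r, PhiH (H (ω j)) σ w) - 2 * q * phiNorm σ M ≤ Phi σ w ∧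
            Phi σ w ≤ ⨅ j : Fin r, PhiH (H (ω j)) σ w) := by
  obtain ⟨g, rfl⟩ : ∃ g : Fin M → A, w = List.ofFn g := by
    subst hw
    exact ⟨w.get, (List.ofFn_get w).symm⟩
  have hpi : ∀ ω : Fin r → Ω, 0 ≤ ∏ j, p (ω j) := fun ω => Finset.prod_nonneg fun j _ => hp _
  have hsum : ∑ ω : Fin r → Ω, ∏ j, p (ω j) = 1 := by
    rw [← Fintype.sum_pow, hp1, one_pow]
  have htail : pr (fun ω : Fin r → Ω => ∏ j, p (ω j))
      (fun ω => 2 * q * phiNorm σ M <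
        (⨅ j : Fin r, PhiH (H (ω j)) σ (List.ofFn g)) - Phi σ (List.ofFn g)) ≤
      (2 : ℝ)⁻¹ ^ r := by
    refine le_trans (pr_mono hpi fun ω hω j => ?_)
      ((pr_pi_forall p (fun ω => 2 * q * phiNorm σ M <
        PhiH (H ω) σ (List.ofFn g) - Phi σ (List.ofFn g)) r).trans_le
        (pow_le_pow_left₀ (pr_nonneg hp _)
          (pr_PhiH_sub_Phi_gt_le_half p hp H hq hcoll σ hσ g) r))
    exact hω.trans_le (sub_le_sub_right (ciInf_le (Set.finite_range _).bddBelow j) _)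
  refine ⟨htail, ?_⟩
  rcases r.eq_zero_or_pos with rfl | hr
  · simpa using pr_nonneg hpi _
  · have : Nonempty (Fin r) := ⟨⟨0, hr⟩⟩
    have hcompl := pr_add_pr_not (fun ω : Fin r → Ω => ∏ j, p (ω j))
      (fun ω => 2 * q * phiNorm σ M <
        (⨅ j : Fin r, PhiH (H (ω j)) σ (List.ofFn g)) - Phi σ (List.ofFn g))
    rw [hsum] at hcompl
    refine (sub_le_iff_le_add'.mpr (hcompl.ge.trans (add_le_add_left htail _))).trans
      (pr_mono hpi fun ω hω => ⟨?_, ?_⟩)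
    · linarith [not_lt.mp hω]
    · exact le_ciInf fun j => sub_nonneg.mp (PhiH_sub_Phi_nonneg (H (ω j)) σ hσ g)
end

section
/- Stream concatenation is multiplication in feature space (Chen's identity): for streams σ and τ over a finite alphabet A and their concatenation (σ,τ), the features with respect to the event map p(λ,a) = 1+λa satisfy, for every word w, Φ_w((σ,τ)) = Σ_{w = uv} Φ_u(σ) · Φ_v(τ), the sum over all splittings of w into a prefix u and a suffix v (including u or v empty). -/
open scoped BigOperators Classical

theorem Fintype.sum_fin_succ_comp {M : Type*} [AddCommMonoid M] {n L : ℕ}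
    (f : (Fin n → Fin (L + 1)) → M) (hf : ∀ i j, i j = 0 → f i = 0) :
    ∑ i, f i = ∑ i : Fin n → Fin L, f (Fin.succ ∘ i) := by
  symm
  refine Fintype.sum_of_injective (fun i : Fin n → Fin L => Fin.succ ∘ i)
    (Fin.succ_injective L).comp_left _ _ (fun i hi => ?_) (fun _ => rfl)
  by_contra hfi
  have h0 : ∀ j, i j ≠ 0 := fun j hj => hfi (hf i j hj)
  exact hi ⟨fun j => (i j).pred (h0 j), by ext j; simp⟩

theorem Fintype.sum_fin_cons {M α : Type*} [AddCommMonoid M] [Fintype α] {n : ℕ}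
    (f : (Fin (n + 1) → α) → M) :
    ∑ i, f i = ∑ a, ∑ i : Fin n → α, f (Fin.cons a i) := by
  rw [← Fintype.sum_prod_type', ← (Fin.consEquiv fun _ => α).sum_comp]
  rfl

theorem Phi_nil {A : Type*} (σ : List (ℝ × A)) : Phi σ [] = 1 := by
  simp [Phi]

theorem Phi_nil_cons {A : Type*} (a : A) (w : List A) : Phi [] (a :: w) = 0 :=
  Fintype.sum_eq_zero _ fun i => (i ⟨0, by simp⟩).elim0

theorem Phi_cons_cons {A : Type*} (e : ℝ × A) (σ : List (ℝ × A)) (a : A) (w : List A) :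
    Phi (e :: σ) (a :: w) =
      (if e.2 = a then e.1 * Phi σ w else 0) + Phi σ (a :: w) := by
  have key : ∀ f : (Fin (w.length + 1) → Fin (σ.length + 1)) → ℝ,
      (∀ i, ∀ j : Fin w.length, i j.succ = 0 → f i = 0) →
      ∑ i, f i = ∑ i : Fin w.length → Fin σ.length, f (Fin.cons 0 (Fin.succ ∘ i)) +
        ∑ i : Fin (w.length + 1) → Fin σ.length, f (Fin.succ ∘ i) := by
    intro f hf
    rw [Fintype.sum_fin_cons, Fin.sum_univ_succ, Fintype.sum_fin_cons]
    congr 1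
    · exact Fintype.sum_fin_succ_comp _ fun i j hj => hf _ j (by simpa using hj)
    · refine Finset.sum_congr rfl fun b _ => ?_
      rw [Fintype.sum_fin_succ_comp _ fun i j hj => hf _ j (by simpa using hj)]
      refine Finset.sum_congr rfl fun i _ => congrArg f ?_
      ext j
      refine Fin.cases ?_ (fun j => ?_) j <;> simp
  refine (key _ ?_).trans (congrArg₂ _ ?_ ?_)
  · intro i j hj
    refine if_neg fun h => ?_
    have := h.1 0 j.succ (Fin.succ_pos j)
    rw [hj] at this
    exact absurd this (Fin.not_lt_zero _)
  · have hmono (i : Fin w.length → Fin σ.length) :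
        (∀ j k : Fin (w.length + 1), j < k →
          (Fin.cons 0 (Fin.succ ∘ i) : Fin (w.length + 1) → Fin (σ.length + 1)) j <
            (Fin.cons 0 (Fin.succ ∘ i) : Fin (w.length + 1) → Fin (σ.length + 1)) k) ↔
          ∀ j k : Fin w.length, j < k → i j < i k := by
      simp [Fin.forall_fin_succ]
    have hletters (i : Fin w.length → Fin σ.length) :
        (∀ j : Fin (w.length + 1), ((e :: σ).get
          ((Fin.cons 0 (Fin.succ ∘ i) : Fin (w.length + 1) → Fin (σ.length + 1)) j)).2 =
            (a :: w).get j) ↔ e.2 = a ∧ ∀ j : Fin w.length, (σ.get (i j)).2 = w.get j := by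
      simp [Fin.forall_fin_succ]
    have hprod (i : Fin w.length → Fin σ.length) :
        ∏ j : Fin (w.length + 1), ((e :: σ).get
          ((Fin.cons 0 (Fin.succ ∘ i) : Fin (w.length + 1) → Fin (σ.length + 1)) j)).1 =
            e.1 * ∏ j : Fin w.length, (σ.get (i j)).1 := by
      simp [Fin.prod_univ_succ]
    split_ifs with ha
    · rw [Phi, Finset.mul_sum]
      refine Finset.sum_congr rfl fun i _ => ?_
      rw [mul_ite, mul_zero]
      refine ite_congr (propext ?_) (fun _ => hprod i) fun _ => rfl
      exact and_congr (hmono i) ((hletters i).trans (and_iff_right ha))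
    · exact Finset.sum_eq_zero fun i _ => if_neg fun h => ha ((hletters i).1 h.2).1
  · refine Finset.sum_congr rfl fun i _ => ?_
    simp [Fin.succ_lt_succ_iff]

/-- Chen's identity for the event map `p(λ,a) = 1 + λ a`: the feature of a concatenation of
streams at a word `w` is the sum over all splittings `w = uv` of the products of the features
of the two streams at the prefix and the suffix. -/
theorem chen_identity {A : Type*} [Fintype A]
    (σ τ : List (ℝ × A)) (hσ : ∀ e ∈ σ, 0 < e.1) (hτ : ∀ e ∈ τ, 0 < e.1) (w : List A) :
    Phi (σ ++ τ) w =
      ∑ k ∈ Finset.range (w.length + 1), Phi σ (w.take k) * Phi τ (w.drop k) := by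
  clear hσ hτ
  induction σ generalizing w with
  | nil =>
    cases w with
    | nil => simp [Phi_nil]
    | cons a w =>
      rw [Finset.sum_range_succ']
      simp [Phi_nil, Phi_nil_cons]
  | cons e σ ih =>
    cases w with
    | nil => simp [Phi_nil]
    | cons a w =>
      rw [List.cons_append, Phi_cons_cons, ih, ih]
      simp only [List.length_cons, Finset.sum_range_succ' _ (w.length + 1),
        List.take_succ_cons, List.drop_succ_cons, List.take_zero, List.drop_zero,
        Phi_cons_cons, Phi_nil, add_mul, Finset.sum_add_distrib]
      split_ifs <;> simp [Finset.mul_sum, mul_assoc, add_assoc]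
end

section
/- Stream concatenation is multiplication in feature space (Chen's identity): for streams σ and τ over a finite alphabet A and their concatenation (σ,τ), the features with respect to the event map p(λ,a) = exp(λa) satisfy, for every word w, Φ_w((σ,τ)) = Σ_{w = uv} Φ_u(σ) · Φ_v(τ), the sum over all splittings of w into a prefix u and a suffix v (including u or v empty). -/
open scoped BigOperators Classical

section ChenIdentity

variable {A : Type*}

/-- The summand of `PhiExp` at the index tuple `i`, for a stream and a word given as functions. -/
noncomputable def expTerm {n L : ℕ} (s : Fin L → ℝ × A) (w : Fin n → A) (i : Fin n → Fin L) : ℝ :=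
  if (∀ j k : Fin n, j ≤ k → i j ≤ i k) ∧ (∀ j : Fin n, (s (i j)).2 = w j) then
    (∏ j : Fin n, (s (i j)).1) / (iFact i : ℝ)
  else 0

theorem PhiExp_eq_sum_expTerm (σ : List (ℝ × A)) (w : List A) {n L : ℕ} (hn : w.length = n)
    (hL : σ.length = L) :
    PhiExp σ w = ∑ i : Fin n → Fin L,
      expTerm (fun l => σ.get (l.cast hL.symm)) (fun j => w.get (j.cast hn.symm)) i := by
  subst hn hL
  rfl

/-- Juxtaposition of an index tuple into the first stream and one into the second stream. -/
def glue {k m L₁ L₂ : ℕ} (p : Fin k → Fin L₁) (q : Fin m → Fin L₂) :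
    Fin (k + m) → Fin (L₁ + L₂) :=
  Fin.append (Fin.castAdd L₂ ∘ p) (Fin.natAdd L₁ ∘ q)

variable {k m L₁ L₂ : ℕ}

@[simp]
theorem glue_castAdd (p : Fin k → Fin L₁) (q : Fin m → Fin L₂) (j : Fin k) :
    glue p q (Fin.castAdd m j) = Fin.castAdd L₂ (p j) := by
  simp [glue]

@[simp]
theorem glue_natAdd (p : Fin k → Fin L₁) (q : Fin m → Fin L₂) (j : Fin m) :
    glue p q (Fin.natAdd k j) = Fin.natAdd L₁ (q j) := by
  simp [glue]

theorem iFact_glue (p : Fin k → Fin L₁) (q : Fin m → Fin L₂) :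
    iFact (glue p q) = iFact p * iFact q := by
  have hne (a : Fin L₁) (b : Fin L₂) : Fin.castAdd L₂ a ≠ Fin.natAdd L₁ b := by
    intro h
    have := congrArg Fin.val h
    simp only [Fin.val_castAdd, Fin.val_natAdd] at this
    omega
  have h₁ (v : Fin L₁) : (List.ofFn (glue p q)).count (Fin.castAdd L₂ v) =
      (List.ofFn p).count v := by
    rw [glue, List.ofFn_fin_append, List.count_append, ← List.map_ofFn, ← List.map_ofFn,
      List.count_map_of_injective _ _ (Fin.castAdd_injective L₁ L₂), Nat.add_eq_left,
      List.count_eq_zero]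
    simpa using fun j => (hne v (q j)).symm
  have h₂ (v : Fin L₂) : (List.ofFn (glue p q)).count (Fin.natAdd L₁ v) =
      (List.ofFn q).count v := by
    rw [glue, List.ofFn_fin_append, List.count_append, ← List.map_ofFn, ← List.map_ofFn,
      List.count_map_of_injective _ _ (Fin.natAdd_injective L₂ L₁), Nat.add_eq_right,
      List.count_eq_zero]
    simpa using fun j => hne (p j) v
  simp only [iFact, Fin.prod_univ_add, h₁, h₂]

theorem glue_monotone_iff (p : Fin k → Fin L₁) (q : Fin m → Fin L₂) :
    (∀ i j, i ≤ j → glue p q i ≤ glue p q j) ↔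
      (∀ i j, i ≤ j → p i ≤ p j) ∧ (∀ i j, i ≤ j → q i ≤ q j) := by
  simp only [Fin.forall_fin_add, glue_castAdd, glue_natAdd, Fin.le_def, Fin.val_castAdd,
    Fin.val_natAdd, add_le_add_iff_left]
  refine ⟨fun h => ⟨fun i => (h.1 i).1, fun i => (h.2 i).2⟩,
    fun h => ⟨fun i => ⟨h.1 i, fun j _ => by omega⟩, fun i => ⟨fun j _ => by omega, h.2 i⟩⟩⟩

theorem expTerm_glue (s : Fin L₁ → ℝ × A) (t : Fin L₂ → ℝ × A) (w : Fin (k + m) → A)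
    (p : Fin k → Fin L₁) (q : Fin m → Fin L₂) :
    expTerm (Fin.append s t) w (glue p q) =
      expTerm s (w ∘ Fin.castAdd m) p * expTerm t (w ∘ Fin.natAdd k) q := by
  simp only [expTerm, glue_monotone_iff]
  simp only [Fin.forall_fin_add, glue_castAdd, glue_natAdd,
    Fin.append_left, Fin.append_right, Function.comp_apply, Fin.prod_univ_add, iFact_glue,
    Nat.cast_mul]
  rw [ite_zero_mul_ite_zero]
  exact if_congr and_and_and_comm (mul_div_mul_comm _ _ _ _) rfl

/-- The tuple `i` takes values in the first block `Fin L₁` exactly at the first `k` positions. -/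
def SplitsAt {n : ℕ} (i : Fin n → Fin (L₁ + L₂)) (k : ℕ) : Prop :=
  ∀ j, (i j : ℕ) < L₁ ↔ (j : ℕ) < k

theorem exists_glue_eq_of_splitsAt {i : Fin (k + m) → Fin (L₁ + L₂)} (h : SplitsAt i k) :
    ∃ (p : Fin k → Fin L₁) (q : Fin m → Fin L₂), glue p q = i := by
  have h₁ (j : Fin k) : (i (Fin.castAdd m j) : ℕ) < L₁ := (h _).2 (by simp)
  have h₂ (j : Fin m) : L₁ ≤ (i (Fin.natAdd k j) : ℕ) := not_lt.1 fun hj => by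
    simpa using (h _).1 hj
  refine ⟨fun j => ⟨i (Fin.castAdd m j), h₁ j⟩,
    fun j => ⟨i (Fin.natAdd k j) - L₁, by have := h₂ j; omega⟩, ?_⟩
  funext j
  refine Fin.addCases (fun j => ?_) (fun j => ?_) j
  · ext
    simp
  · ext
    have := h₂ j
    simp only [glue_natAdd, Fin.val_natAdd]
    omega

theorem splitsAt_glue (p : Fin k → Fin L₁) (q : Fin m → Fin L₂) : SplitsAt (glue p q) k := by
  simp [SplitsAt, Fin.forall_fin_add]

theorem glue_injective : Function.Injective
    fun x : (Fin k → Fin L₁) × (Fin m → Fin L₂) => glue x.1 x.2 := by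
  rintro ⟨p, q⟩ ⟨p', q'⟩ h
  refine Prod.ext (funext fun j => ?_) (funext fun j => ?_)
  · simpa using congrFun h (Fin.castAdd m j)
  · simpa using congrFun h (Fin.natAdd k j)

theorem sum_splitsAt_eq_mul (s : Fin L₁ → ℝ × A) (t : Fin L₂ → ℝ × A) (w : Fin (k + m) → A) :
    (∑ i : Fin (k + m) → Fin (L₁ + L₂), if SplitsAt i k then expTerm (Fin.append s t) w i else 0) =
      (∑ p, expTerm s (w ∘ Fin.castAdd m) p) * ∑ q, expTerm t (w ∘ Fin.natAdd k) q := by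
  rw [Finset.sum_mul_sum, ← Fintype.sum_prod_type']
  symm
  refine Finset.sum_of_injOn (fun x => glue x.1 x.2) glue_injective.injOn (by simp) ?_ ?_
  · intro i _ hi
    rw [if_neg]
    intro h
    obtain ⟨p, q, rfl⟩ := exists_glue_eq_of_splitsAt h
    exact hi ⟨(p, q), by simp, rfl⟩
  · rintro ⟨p, q⟩ _
    rw [if_pos (splitsAt_glue p q), expTerm_glue]

theorem exists_splitsAt {n : ℕ} {i : Fin n → Fin (L₁ + L₂)} (hi : ∀ j k, j ≤ k → i j ≤ i k) :
    ∃ k : Fin (n + 1), SplitsAt i k := by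
  have hex : ∃ k : ℕ, ∀ j : Fin n, k ≤ j → L₁ ≤ (i j : ℕ) := ⟨n, fun j hj => by omega⟩
  refine ⟨⟨Nat.find hex, Nat.lt_succ_of_le (Nat.find_min' hex fun j hj => by omega)⟩, fun j => ?_⟩
  refine ⟨fun hj => not_le.1 fun hk => not_le.2 hj (Nat.find_spec hex j hk), fun hj => ?_⟩
  have := Nat.find_min hex hj
  push Not at this
  obtain ⟨j', hjj', hj'⟩ := this
  exact lt_of_le_of_lt (hi j j' hjj') hj'

theorem SplitsAt.unique {n : ℕ} {i : Fin n → Fin (L₁ + L₂)} {k k' : Fin (n + 1)}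
    (h : SplitsAt i k) (h' : SplitsAt i k') : k = k' := by
  refine le_antisymm (not_lt.1 fun hlt => ?_) (not_lt.1 fun hlt => ?_)
  · exact lt_irrefl _ ((h' ⟨k', by omega⟩).1 ((h ⟨k', by omega⟩).2 hlt))
  · exact lt_irrefl _ ((h ⟨k, by omega⟩).1 ((h' ⟨k, by omega⟩).2 hlt))

theorem sum_expTerm_eq_sum_splitsAt {n : ℕ} (s : Fin (L₁ + L₂) → ℝ × A) (w : Fin n → A) :
    ∑ i, expTerm s w i =
      ∑ k : Fin (n + 1), ∑ i, if SplitsAt i k then expTerm s w i else 0 := by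
  rw [Finset.sum_comm]
  refine Finset.sum_congr rfl fun i _ => ?_
  by_cases hi : ∀ j k, j ≤ k → i j ≤ i k
  · obtain ⟨k, hk⟩ := exists_splitsAt hi
    rw [Finset.sum_eq_single k (fun k' _ hne => if_neg fun h => hne (h.unique hk)) (by simp),
      if_pos hk]
  · simp [expTerm, hi]

end ChenIdentity

/-- Chen's identity for the event map `p(λ,a) = exp(λ a)`: the feature of a concatenation of
streams at a word `w` is the sum over all splittings `w = uv` of the products of the features
of the two streams at the prefix and the suffix. -/
theorem chen_identity_exp {A : Type*} [Fintype A]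
    (σ τ : List (ℝ × A)) (hσ : ∀ e ∈ σ, 0 < e.1) (hτ : ∀ e ∈ τ, 0 < e.1) (w : List A) :
    PhiExp (σ ++ τ) w =
      ∑ k ∈ Finset.range (w.length + 1), PhiExp σ (w.take k) * PhiExp τ (w.drop k) := by
  have hL : (σ ++ τ).length = σ.length + τ.length := List.length_append
  rw [Finset.sum_range, PhiExp_eq_sum_expTerm (σ ++ τ) w rfl hL, sum_expTerm_eq_sum_splitsAt]
  have happ : (fun l => (σ ++ τ).get (Fin.cast hL.symm l)) = Fin.append σ.get τ.get := by
    funext l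
    refine Fin.addCases (fun l => ?_) (fun l => ?_) l <;> simp
  rw [happ]
  refine Finset.sum_congr rfl fun k _ => ?_
  obtain ⟨m, hm⟩ := Nat.exists_eq_add_of_le (Nat.le_of_lt_succ k.isLt)
  have hsplit {n : ℕ} (hn : w.length = n) :
      (∑ i : Fin w.length → Fin (σ.length + τ.length),
        if SplitsAt i k then expTerm (Fin.append σ.get τ.get)
          (fun j => w.get (j.cast rfl)) i else 0) =
      ∑ i : Fin n → Fin (σ.length + τ.length),
        if SplitsAt i k then expTerm (Fin.append σ.get τ.get)
          (fun j => w.get (j.cast hn.symm)) i else 0 := by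
    subst hn
    rfl
  have hu : (w.take k).length = k := by simp; omega
  have hv : (w.drop k).length = m := by simp; omega
  rw [hsplit hm, sum_splitsAt_eq_mul, PhiExp_eq_sum_expTerm σ _ hu rfl,
    PhiExp_eq_sum_expTerm τ _ hv rfl]
  congr! 4 <;> simp
end

section
/- Shuffle identity (group-like property of the features for the event map p(λ,a) = exp(λa)): for every stream σ over a finite alphabet A and all words u, v over A, Φ_u(σ) · Φ_v(σ) = Σ_w ⟨u ⧢ v, w⟩ · Φ_w(σ), where the sum runs over all words w of length |u| + |v| and ⟨u ⧢ v, w⟩ denotes the coefficient of w in the shuffle product of u and v. -/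
open scoped BigOperators Classical

/-- The shuffle product of two words, as a formal (multiset) sum of words. -/
def shuffle {A : Type*} : List A → List A → Multiset (List A)
  | [], v => {v}
  | a :: u, [] => {a :: u}
  | a :: u, b :: v =>
      (shuffle u (b :: v)).map (fun w => a :: w) +
        (shuffle (a :: u) v).map (fun w => b :: w)
termination_by u v => u.length + v.length

lemma iFact_pos {M L : ℕ} (i : Fin M → Fin L) : 0 < iFact i :=
  Finset.prod_pos fun _ _ => Nat.factorial_pos _

lemma iFact_cons_zero {M L : ℕ} (i : Fin M → Fin (L + 1)) :
    iFact (Fin.cons 0 i : Fin (M + 1) → Fin (L + 1)) =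
      ((List.ofFn i).count 0 + 1) * iFact i := by
  unfold iFact
  rw [Fin.prod_univ_succ, Fin.prod_univ_succ (n := L)]
  simp only [List.ofFn_succ, Fin.cons_zero, Fin.cons_succ, List.count_cons_self,
    Nat.factorial_succ, mul_assoc]
  congr 2

lemma iFact_succ_comp {M L : ℕ} (i : Fin M → Fin L) :
    iFact (fun j => (i j).succ) = iFact i := by
  have h : List.ofFn (fun j => (i j).succ) = (List.ofFn i).map Fin.succ := by
    rw [List.map_ofFn]; rfl
  unfold iFact
  rw [Fin.prod_univ_succ, h, List.count_eq_zero_of_not_mem (by simp [Fin.succ_ne_zero])]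
  simp only [Nat.factorial_zero, one_mul]
  exact Finset.prod_congr rfl fun v _ => by
    rw [List.count_map_of_injective _ _ (Fin.succ_injective L)]

lemma PhiExp_nil_right {A : Type*} (σ : List (ℝ × A)) : PhiExp σ [] = 1 := by
  simp [PhiExp, iFact]

lemma PhiExp_nil_left {A : Type*} (b : A) (w : List A) :
    PhiExp ([] : List (ℝ × A)) (b :: w) = 0 :=
  Finset.sum_eq_zero fun i _ => (i ⟨0, by simp⟩).elim0

/-- An event with zero counter increase does not change the features. -/
lemma PhiExp_cons_zero {A : Type*} (a : A) (σ : List (ℝ × A)) (w : List A) :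
    PhiExp ((0, a) :: σ) w = PhiExp σ w := by
  symm
  refine Fintype.sum_of_injective
    (fun (i : Fin w.length → Fin σ.length) (j : Fin w.length) => (i j).succ)
    (fun i i' h => funext fun j => Fin.succ_injective _ (congrFun h j)) _ _ ?_ ?_
  · intro i hi
    have : ∃ j, i j = (0 : Fin (σ.length + 1)) := by
      by_contra! h
      exact hi ⟨fun j => (i j).pred (h j), funext fun j => Fin.succ_pred _ _⟩
    obtain ⟨j, hj⟩ := this
    refine ite_eq_right_iff.2 fun _ => ?_
    rw [Finset.prod_eq_zero (Finset.mem_univ j), zero_div]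
    rw [hj]; rfl
  · intro i
    have h : iFact (L := ((0, a) :: σ).length) (fun j => (i j).succ) = iFact i :=
      iFact_succ_comp i
    simp [h]

/-- The product along an index tuple is a monomial in the counter increase of the first event. -/
lemma exists_prod_get_cons {A : Type*} (a : A) (σ : List (ℝ × A)) {M : ℕ}
    (i : Fin M → Fin (σ.length + 1)) :
    ∃ C : ℝ, ∀ x : ℝ, ∏ j, (((x, a) :: σ).get (i j)).1 = x ^ (List.ofFn i).count 0 * C := by
  induction M with
  | zero => exact ⟨1, by simp⟩
  | succ M ih =>
    obtain ⟨C, hC⟩ := ih fun j => i j.succ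
    obtain h | ⟨k, hk⟩ := Fin.eq_zero_or_eq_succ (i 0)
    · refine ⟨C, fun x => ?_⟩
      rw [Fin.prod_univ_succ, hC, List.ofFn_succ, h, List.count_cons_self, pow_succ]
      simp only [List.get_eq_getElem, Fin.val_zero, List.getElem_cons_zero]
      ring
    · refine ⟨(σ.get k).1 * C, fun x => ?_⟩
      rw [Fin.prod_univ_succ, hC, List.ofFn_succ, hk,
        List.count_cons_of_ne (Fin.succ_ne_zero k)]
      simp only [List.get_eq_getElem, Fin.val_succ, List.getElem_cons_succ]
      ring

/-- The features of a nonempty word, as a function of the counter increase of the first event,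
are an antiderivative of the features of its tail if the first letters agree, and constant
otherwise. -/
lemma hasDerivAt_PhiExp_cons {A : Type*} (a b : A) (σ : List (ℝ × A)) (w : List A) (x : ℝ) :
    HasDerivAt (fun x => PhiExp ((x, a) :: σ) (b :: w))
      (if a = b then PhiExp ((x, a) :: σ) w else 0) x := by
  let T (x : ℝ) (i : Fin (w.length + 1) → Fin (σ.length + 1)) : ℝ :=
    if (∀ j k, j ≤ k → i j ≤ i k) ∧
        (∀ j, (((x, a) :: σ).get (i j)).2 = (b :: w).get j) then
      (∏ j, (((x, a) :: σ).get (i j)).1) / (iFact i : ℝ)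
    else 0
  have hT (x : ℝ) : PhiExp ((x, a) :: σ) (b :: w) =
      ∑ i' : Fin w.length → Fin (σ.length + 1), T x (Fin.cons 0 i') +
      ∑ k : Fin σ.length, ∑ i' : Fin w.length → Fin (σ.length + 1),
        T x (Fin.cons k.succ i') := by
    rw [← Fin.sum_univ_succ
      (fun k => ∑ i' : Fin w.length → Fin (σ.length + 1), T x (Fin.cons k i')),
      ← Fintype.sum_prod_type' (fun k i' => T x (Fin.cons k i'))]
    exact ((Fin.consEquiv fun _ : Fin (w.length + 1) => Fin (σ.length + 1)).sum_comp (T x)).symm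
  have hconst (k : Fin σ.length) (i' : Fin w.length → Fin (σ.length + 1)) (x : ℝ) :
      T x (Fin.cons k.succ i') = T 0 (Fin.cons k.succ i') := by
    by_cases hm : ∀ j l, j ≤ l →
        (Fin.cons k.succ i' : Fin (w.length + 1) → Fin (σ.length + 1)) j ≤
        (Fin.cons k.succ i' : Fin (w.length + 1) → Fin (σ.length + 1)) l
    · have hget (j : Fin (w.length + 1)) :
          ((x, a) :: σ).get
            ((Fin.cons k.succ i' : Fin (w.length + 1) → Fin (σ.length + 1)) j) =
          ((0, a) :: σ).get
            ((Fin.cons k.succ i' : Fin (w.length + 1) → Fin (σ.length + 1)) j) := by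
        have h := hm 0 j (Fin.zero_le j)
        obtain h0 | ⟨l, hl⟩ := Fin.eq_zero_or_eq_succ
          ((Fin.cons k.succ i' : Fin (w.length + 1) → Fin (σ.length + 1)) j)
        · rw [h0, Fin.cons_zero] at h
          exact absurd (Fin.le_zero_iff.1 h) (Fin.succ_ne_zero k)
        · rw [hl]; rfl
      simp only [T, hget]
    · simp only [T, if_neg (fun h => hm (And.left h))]
  have hzero (i' : Fin w.length → Fin (σ.length + 1)) :
      HasDerivAt (fun x => T x (Fin.cons 0 i'))
        (if a = b then
          if (∀ j k : Fin w.length, j ≤ k → i' j ≤ i' k) ∧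
              (∀ j : Fin w.length, (((x, a) :: σ).get (i' j)).2 = w.get j) then
            (∏ j : Fin w.length, (((x, a) :: σ).get (i' j)).1) / (iFact i' : ℝ)
          else 0
        else 0) x := by
    obtain ⟨C, hC⟩ := exists_prod_get_cons a σ i'
    have hletter (y : ℝ) (k : Fin (σ.length + 1)) :
        (((y, a) :: σ).get k).2 = (((x, a) :: σ).get k).2 := by
      obtain rfl | ⟨l, rfl⟩ := Fin.eq_zero_or_eq_succ k <;> rfl
    have hmono : (∀ j k, j ≤ k →
        (Fin.cons 0 i' : Fin (w.length + 1) → Fin (σ.length + 1)) j ≤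
        (Fin.cons 0 i' : Fin (w.length + 1) → Fin (σ.length + 1)) k) ↔
        ∀ j k, j ≤ k → i' j ≤ i' k := by
      simp [Fin.forall_fin_succ]
    have hTx : (fun y => T y (Fin.cons 0 i')) = fun y =>
        if a = b then
          if (∀ j k : Fin w.length, j ≤ k → i' j ≤ i' k) ∧
              (∀ j : Fin w.length, (((x, a) :: σ).get (i' j)).2 = w.get j) then
            y ^ ((List.ofFn i').count 0 + 1) * C /
              ((((List.ofFn i').count 0 + 1) * iFact i' : ℕ) : ℝ)
          else 0
        else 0 := by
      funext y
      rw [← ite_and]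
      refine if_congr ?_ ?_ rfl
      · rw [hmono, Fin.forall_fin_succ]
        simp only [hletter y, Fin.cons_succ, Fin.cons_zero]
        change _ ∧ a = b ∧ _ ↔ _
        simp only [List.get_cons_succ']
        tauto
      · rw [Fin.prod_univ_succ, iFact_cons_zero]
        simp only [Fin.cons_succ, hC]
        simp only [Fin.cons_zero, List.get_eq_getElem, Fin.val_zero, List.getElem_cons_zero]
        ring
    rw [hTx]
    split_ifs
    · rw [hC]
      have hF : (iFact i' : ℝ) ≠ 0 := by exact_mod_cast (iFact_pos i').ne'
      have hc : ((List.ofFn i').count 0 + 1 : ℝ) ≠ 0 := by positivity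
      refine (((hasDerivAt_pow ((List.ofFn i').count 0 + 1) x).mul_const C).div_const _).congr_deriv
        ?_
      push_cast
      field_simp
    · exact hasDerivAt_const _ _
    · exact hasDerivAt_const _ _
  simp only [hT, hconst]
  refine ((HasDerivAt.fun_sum fun i' _ => hzero i').add_const _).congr_deriv ?_
  split_ifs
  · rfl
  · simp

lemma hasDerivAt_sum_map_PhiExp_cons {A : Type*} (a b : A) (σ : List (ℝ × A))
    (S : Multiset (List A)) (x : ℝ) :
    HasDerivAt (fun x => ((S.map fun w => b :: w).map (PhiExp ((x, a) :: σ))).sum)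
      (if a = b then (S.map (PhiExp ((x, a) :: σ))).sum else 0) x := by
  induction S using Multiset.induction_on with
  | empty => simpa using hasDerivAt_const x (0 : ℝ)
  | cons w S ih =>
    simp only [Multiset.map_cons, Multiset.sum_cons]
    refine ((hasDerivAt_PhiExp_cons a b σ w x).add ih).congr_deriv ?_
    split_ifs <;> simp

lemma length_of_mem_shuffle {A : Type*} {u v w : List A} (h : w ∈ shuffle u v) :
    w.length = u.length + v.length := by
  induction u, v using shuffle.induct generalizing w with
  | case1 v => simp_all [shuffle]
  | case2 a u => simp_all [shuffle]
  | case3 a u b v ih₁ ih₂ =>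
    rw [shuffle, Multiset.mem_add, Multiset.mem_map, Multiset.mem_map] at h
    obtain ⟨w, hw, rfl⟩ | ⟨w, hw, rfl⟩ := h
    · have := ih₁ hw
      simp only [List.length_cons] at *
      omega
    · have := ih₂ hw
      simp only [List.length_cons] at *
      omega

lemma PhiExp_mul {A : Type*} (σ : List (ℝ × A)) (u v : List A) :
    PhiExp σ u * PhiExp σ v = ((shuffle u v).map (PhiExp σ)).sum := by
  induction σ generalizing u v with
  | nil =>
    cases u with
    | nil => simp [shuffle, PhiExp_nil_right]
    | cons a u =>
      rw [PhiExp_nil_left, zero_mul, Multiset.sum_eq_zero]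
      intro y hy
      obtain ⟨w, hw, rfl⟩ := Multiset.mem_map.1 hy
      cases w with
      | nil =>
        have := length_of_mem_shuffle hw
        simp only [List.length_nil, List.length_cons] at this
        omega
      | cons b w => exact PhiExp_nil_left b w
  | cons e σ ihσ =>
    obtain ⟨l, a⟩ := e
    induction u, v using shuffle.induct generalizing l with
    | case1 v => simp [shuffle, PhiExp_nil_right]
    | case2 b u => simp [shuffle, PhiExp_nil_right]
    | case3 b u c v ih₁ ih₂ =>
      let D (x : ℝ) : ℝ := PhiExp ((x, a) :: σ) (b :: u) * PhiExp ((x, a) :: σ) (c :: v) -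
        ((shuffle (b :: u) (c :: v)).map (PhiExp ((x, a) :: σ))).sum
      have hD (x : ℝ) : HasDerivAt D 0 x := by
        simp only [D, shuffle, Multiset.map_add, Multiset.sum_add]
        refine (((hasDerivAt_PhiExp_cons a b σ u x).mul (hasDerivAt_PhiExp_cons a c σ v x)).sub
          ((hasDerivAt_sum_map_PhiExp_cons a b σ _ x).add
            (hasDerivAt_sum_map_PhiExp_cons a c σ _ x))).congr_deriv ?_
        rw [← ih₁, ← ih₂]
        split_ifs <;> ring
      have h0 : D 0 = 0 := by
        have : PhiExp ((0, a) :: σ) = PhiExp σ := funext (PhiExp_cons_zero a σ)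
        simp only [D, this, ihσ, sub_self]
      have := is_const_of_deriv_eq_zero (fun x => (hD x).differentiableAt)
        (fun x => (hD x).deriv) l 0
      exact sub_eq_zero.1 (this.trans h0)

lemma sum_count_ofFn_mul {A : Type*} [Fintype A] (n : ℕ) (g : List A → ℝ)
    (S : Multiset (List A)) (hS : ∀ w ∈ S, w.length = n) :
    ∑ f : Fin n → A, (S.count (List.ofFn f) : ℝ) * g (List.ofFn f) = (S.map g).sum := by
  induction S using Multiset.induction_on with
  | empty => simp
  | cons w S ih =>
    rw [Multiset.map_cons, Multiset.sum_cons, ← ih fun w hw => hS w (Multiset.mem_cons_of_mem hw)]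
    obtain rfl := hS w (Multiset.mem_cons_self w S)
    simp only [Multiset.count_cons, Nat.cast_add, add_mul, Finset.sum_add_distrib]
    rw [add_comm, Finset.sum_eq_single w.get]
    · simp
    · intro f _ hf
      rw [if_neg, Nat.cast_zero, zero_mul]
      exact fun h => hf (List.ofFn_injective (h.trans (List.ofFn_get w).symm))
    · simp

/-- Shuffle identity (group-like property) for the event map `p(λ,a) = exp(λ a)`:
`Φ_u(σ) Φ_v(σ) = Σ_w ⟨u ⧢ v, w⟩ Φ_w(σ)`, the sum over all words `w` of length
`|u| + |v|`. -/
theorem shuffle_identity {A : Type*} [Fintype A]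
    (σ : List (ℝ × A)) (hσ : ∀ e ∈ σ, 0 < e.1) (u v : List A) :
    PhiExp σ u * PhiExp σ v =
      ∑ f : Fin (u.length + v.length) → A,
        ((shuffle u v).count (List.ofFn f) : ℝ) * PhiExp σ (List.ofFn f) := by
  rw [PhiExp_mul, ← sum_count_ofFn_mul _ _ _ fun w hw => length_of_mem_shuffle hw]
end

section
/- Point separation of the feature map for the event map p(λ,a) = 1+λa: let σ = ((λ_i,a_i))_{i=1}^L be a stream over a finite alphabet A with all λ_i > 0 and let u = a_1⋯a_L be its letter word. Then (i) Φ_u(σ) = λ_1⋯λ_L > 0; (ii) Φ_w(σ) = 0 for every word w with |w| = L and w ≠ u; (iii) Φ_w(σ) = 0 for every word w with |w| > L. Consequently, two streams whose letter words are different (in particular, streams of different lengths) have different feature collections (Φ_w)_w. -/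
open scoped BigOperators Classical

/-- An index tuple contributing to a feature coordinate at a word as long as the stream is the
identity tuple. -/
theorem val_eq_of_strictMono {m n : ℕ} (hmn : m = n) {i : Fin m → Fin n} (hi : StrictMono i)
    (j : Fin m) : (i j : ℕ) = j := by
  subst hmn
  exact congrArg Fin.val (le_antisymm hi.apply_le hi.le_apply)

theorem Phi_eq_zero_of_length_lt {A : Type*} {σ : List (ℝ × A)} {w : List A}
    (h : σ.length < w.length) : Phi σ w = 0 := by
  refine Finset.sum_eq_zero fun i _ => if_neg fun hi => ?_
  have hmono : StrictMono i := fun j k hjk => hi.1 j k hjk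
  have hcard := Fintype.card_le_of_injective i hmono.injective
  simp only [Fintype.card_fin] at hcard
  omega

theorem Phi_eq_zero_of_ne {A : Type*} {σ : List (ℝ × A)} {w : List A}
    (h : w.length = σ.length) (hw : w ≠ σ.map Prod.snd) : Phi σ w = 0 := by
  refine Finset.sum_eq_zero fun i _ => if_neg fun hi => hw ?_
  have hmono : StrictMono i := fun j k hjk => hi.1 j k hjk
  refine List.ext_get (by simpa using h) fun n hn _ => ?_
  have hval := val_eq_of_strictMono h hmono ⟨n, hn⟩
  simpa [hval] using (hi.2 ⟨n, hn⟩).symm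

theorem Phi_map_snd {A : Type*} (σ : List (ℝ × A)) :
    Phi σ (σ.map Prod.snd) = (σ.map Prod.fst).prod := by
  have hlen : (σ.map Prod.snd).length = σ.length := List.length_map _
  unfold Phi
  rw [Finset.sum_eq_single (Fin.cast hlen)]
  · rw [if_pos ⟨fun _ _ hjk => hjk, fun j => by simp⟩, ← List.prod_ofFn]
    congr 1
    apply List.ext_get <;> simp
  · intro i _ hne
    refine if_neg fun hi => hne ?_
    have hmono : StrictMono i := fun j k hjk => hi.1 j k hjk
    exact funext fun j => Fin.ext (val_eq_of_strictMono hlen hmono j)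
  · exact fun h => absurd (Finset.mem_univ _) h

theorem Phi_map_snd_pos {A : Type*} {σ : List (ℝ × A)} (hσ : ∀ e ∈ σ, 0 < e.1) :
    0 < Phi σ (σ.map Prod.snd) := by
  rw [Phi_map_snd]
  refine List.prod_pos fun x hx => ?_
  obtain ⟨e, he, rfl⟩ := List.mem_map.1 hx
  exact hσ e he

/-- The letter word of the longer of two streams separates them. -/
theorem Phi_ne_of_length_le {A : Type*} {σ τ : List (ℝ × A)} (hσ : ∀ e ∈ σ, 0 < e.1)
    (hlen : τ.length ≤ σ.length) (hne : σ.map Prod.snd ≠ τ.map Prod.snd) :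
    Phi σ (σ.map Prod.snd) ≠ Phi τ (σ.map Prod.snd) := by
  have hzero : Phi τ (σ.map Prod.snd) = 0 := by
    rcases hlen.lt_or_eq with h | h
    · exact Phi_eq_zero_of_length_lt (by simpa using h)
    · exact Phi_eq_zero_of_ne (by simpa using h.symm) hne
  rw [hzero]
  exact (Phi_map_snd_pos hσ).ne'

/-- Point separation for the event map `p(λ,a) = 1 + λ a`: for a stream `σ` with letter word
`u = a_1⋯a_L`, (i) `Φ_u(σ) = λ_1⋯λ_L > 0`; (ii) `Φ_w(σ) = 0` for every word `w ≠ u` of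
length `L`; (iii) `Φ_w(σ) = 0` for words longer than `L`.  Consequently, streams with
different letter words have different feature collections. -/
theorem point_separation {A : Type*} [Fintype A]
    (σ : List (ℝ × A)) (hσ : ∀ e ∈ σ, 0 < e.1) :
    (Phi σ (σ.map Prod.snd) = (σ.map Prod.fst).prod ∧ 0 < Phi σ (σ.map Prod.snd)) ∧
      (∀ w : List A, w.length = σ.length → w ≠ σ.map Prod.snd → Phi σ w = 0) ∧
      (∀ w : List A, σ.length < w.length → Phi σ w = 0) ∧
      (∀ τ : List (ℝ × A), (∀ e ∈ τ, 0 < e.1) → σ.map Prod.snd ≠ τ.map Prod.snd →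
        ∃ w : List A, Phi σ w ≠ Phi τ w) := by
  refine ⟨⟨Phi_map_snd σ, Phi_map_snd_pos hσ⟩, fun _ => Phi_eq_zero_of_ne,
    fun _ => Phi_eq_zero_of_length_lt, fun τ hτ hne => ?_⟩
  rcases le_total τ.length σ.length with h | h
  · exact ⟨_, Phi_ne_of_length_le hσ h hne⟩
  · exact ⟨_, (Phi_ne_of_length_le hτ h hne.symm).symm⟩
end

section
/- The affine modular family of hash functions is 2-universal: let A = {1,…,m} and B = {1,…,n} with n ≤ m, let p be a prime with p ≥ m, and let 𝓗 = { h_{a,b} : 1 ≤ a ≤ p−1, 0 ≤ b ≤ p−1 }, where h_{a,b}(x) = (((a·x + b) mod p) mod n). Then for H drawn uniformly from 𝓗 (i.e. (a,b) uniform on {1,…,p−1} × {0,…,p−1}) and any two distinct x, y ∈ A, ℙ( H(x) = H(y) ) ≤ 1/n. -/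
open scoped BigOperators

theorem Nat.card_filter_ne_and_mod_eq_le {n p u : ℕ} (hu : u < p) :
    ((Finset.range p).filter (fun v => v ≠ u ∧ u % n = v % n)).card ≤ (p - 1) / n := by
  set S := (Finset.range p).filter (fun v => v ≠ u ∧ u % n = v % n) with hS
  have h_not_mem : u ∉ S := by simp [hS]
  have h_card : (insert u S).card ≤ (Finset.range ((p - 1) / n + 1)).card := by
    refine Finset.card_le_card_of_injOn (· / n) ?_ ?_
    · intro v hv
      have hvp : v ≤ p - 1 := by
        simp only [hS, Finset.coe_insert, Finset.coe_filter, Set.mem_insert_iff,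
          Set.mem_ofPred_eq, Finset.mem_range] at hv
        omega
      simpa [Nat.lt_succ_iff] using Nat.div_le_div_right (c := n) hvp
    · have h_mod : ∀ v ∈ (↑(insert u S) : Set ℕ), v % n = u % n := by
        intro v hv
        simp only [hS, Finset.coe_insert, Finset.coe_filter, Set.mem_insert_iff,
          Set.mem_ofPred_eq, Finset.mem_range] at hv
        rcases hv with rfl | hv
        · rfl
        · exact hv.2.2.symm
      intro v hv w hw hvw
      have h_div : v / n = w / n := hvw
      rw [← Nat.div_add_mod v n, ← Nat.div_add_mod w n, h_div, h_mod v hv, h_mod w hw]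
  rw [Finset.card_insert_of_notMem h_not_mem, Finset.card_range] at h_card
  omega

theorem ZMod.natCast_injOn_Icc_one (p : ℕ) :
    Set.InjOn (Nat.cast : ℕ → ZMod p) (Set.Icc 1 p) := by
  intro x hx y hy h
  have hd := (Nat.modEq_iff_dvd.1 ((ZMod.natCast_eq_natCast_iff x y p).1 h))
  have h_zero := Int.eq_zero_of_abs_lt_dvd hd (by
    rw [abs_lt]
    have := hx.1; have := hx.2; have := hy.1; have := hy.2
    constructor <;> omega)
  omega

theorem card_filter_affine_mod_collision_le {n p x y : ℕ} (hp : p.Prime)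
    (hxy : (x : ZMod p) ≠ y) :
    ((Finset.Icc 1 (p - 1) ×ˢ Finset.Icc 0 (p - 1)).filter
      (fun ab : ℕ × ℕ =>
        ((ab.1 * x + ab.2) % p) % n = ((ab.1 * y + ab.2) % p) % n)).card ≤
      p * ((p - 1) / n) := by
  have : Fact p.Prime := ⟨hp⟩
  have hp0 := hp.pos
  have h_sub : (x : ZMod p) - y ≠ 0 := sub_ne_zero.2 hxy
  have h_cast {a b z a' b' z' : ℕ} (h : (a * z + b) % p = (a' * z' + b') % p) :
      (a * z + b : ZMod p) = a' * z' + b' := by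
    exact_mod_cast (ZMod.natCast_eq_natCast_iff _ _ p).2 h
  have h_inj {s t : ℕ} (hs : s < p) (ht : t < p) (h : (s : ZMod p) = t) : s = t :=
    Nat.ModEq.eq_of_lt_of_lt ((ZMod.natCast_eq_natCast_iff _ _ p).1 h) hs ht
  calc
    _ ≤ ((Finset.range p).sigma fun u =>
        (Finset.range p).filter fun v => v ≠ u ∧ u % n = v % n).card := by
      refine Finset.card_le_card_of_injOn
        (fun ab => ⟨(ab.1 * x + ab.2) % p, (ab.1 * y + ab.2) % p⟩) ?_ ?_
      · rintro ⟨a, b⟩ hab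
        simp only [Finset.coe_filter, Finset.mem_product, Finset.mem_Icc,
          Set.mem_ofPred_eq] at hab
        simp only [Finset.mem_coe, Finset.mem_sigma, Finset.mem_filter, Finset.mem_range]
        refine ⟨Nat.mod_lt _ hp0, Nat.mod_lt _ hp0, fun h => ?_, hab.2⟩
        have h_mul : (a : ZMod p) * (x - y) = 0 := by linear_combination -h_cast h
        have ha : a = 0 := h_inj (by omega) hp0 (by
          simpa using (mul_eq_zero.1 h_mul).resolve_right h_sub)
        omega
      · rintro ⟨a, b⟩ hab ⟨c, d⟩ hcd h
        simp only [Finset.coe_filter, Finset.mem_product, Finset.mem_Icc,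
          Set.mem_ofPred_eq] at hab hcd
        simp only [Sigma.mk.injEq, heq_eq_eq] at h
        have hx := h_cast h.1
        have hy := h_cast h.2
        have h_mul : ((a : ZMod p) - c) * (x - y) = 0 := by linear_combination hx - hy
        have h_fst : (a : ZMod p) = c :=
          sub_eq_zero.1 ((mul_eq_zero.1 h_mul).resolve_right h_sub)
        have h_snd : (b : ZMod p) = d := by linear_combination hx - x * h_fst
        rw [h_inj (by omega) (by omega) h_fst, h_inj (by omega) (by omega) h_snd]
    _ ≤ p * ((p - 1) / n) := by
      rw [Finset.card_sigma]
      refine (Finset.sum_le_card_nsmul _ _ ((p - 1) / n) fun u hu =>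
        Nat.card_filter_ne_and_mod_eq_le (Finset.mem_range.1 hu)).trans ?_
      simp

/-- The affine modular family `h_{a,b}(x) = ((a x + b) mod p) mod n`, with `(a,b)` drawn
uniformly from `{1,…,p-1} × {0,…,p-1}` for a prime `p ≥ m`, is 2-universal: for any two
distinct `x, y ∈ {1,…,m}`, the collision probability is at most `1/n`. -/
theorem affine_modular_two_universal (m n p : ℕ) (hn : 0 < n) (hnm : n ≤ m)
    (hp : p.Prime) (hmp : m ≤ p)
    (x y : ℕ) (hx : x ∈ Finset.Icc 1 m) (hy : y ∈ Finset.Icc 1 m) (hxy : x ≠ y) :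
    (((Finset.Icc 1 (p - 1) ×ˢ Finset.Icc 0 (p - 1)).filter
          (fun ab : ℕ × ℕ =>
            ((ab.1 * x + ab.2) % p) % n = ((ab.1 * y + ab.2) % p) % n)).card : ℝ) /
        (((p - 1) * p : ℕ) : ℝ) ≤ 1 / (n : ℝ) := by
  rw [Finset.mem_Icc] at hx hy
  have h_card := card_filter_affine_mod_collision_le (n := n) hp
    (fun h => hxy (ZMod.natCast_injOn_Icc_one p ⟨hx.1, hx.2.trans hmp⟩
      ⟨hy.1, hy.2.trans hmp⟩ h))
  have h_pos : 0 < (p - 1) * p := Nat.mul_pos (Nat.sub_pos_of_lt hp.one_lt) hp.pos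
  rw [div_le_div_iff₀ (by exact_mod_cast h_pos) (by exact_mod_cast hn), one_mul]
  norm_cast
  calc
    _ ≤ p * ((p - 1) / n) * n := Nat.mul_le_mul_right n h_card
    _ = p * ((p - 1) / n * n) := mul_assoc _ _ _
    _ ≤ p * (p - 1) := Nat.mul_le_mul_left p (Nat.div_mul_le_self _ _)
    _ = (p - 1) * p := mul_comm _ _
end
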